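/- Let C_i be a cable line from S_i to T_i and C_j a cable line from S_j to T_j in the plane ℝ², with C_i and C_j disjoint. Let Π_i (respectively Π_j) denote the cable polygon of C_i (respectively C_j), each assumed to be a Jordan curve. If S_i is exterior to Π_j, S_j and T_j are exterior to Π_i, and T_i lies in the interior of Π_j, then the closed straight-line segments [S_i, T_i] and [S_j, T_j] must intersect. -/

import Mathlib

open Set

noncomputable section

/-- The Euclidean plane ℝ². -/
abbrev Plane := EuclideanSpace ℝ (Fin 2)

/-- A cable line from `S` to `T`: a polygonal chain (union of closed segments through
consecutive points) whose first point is `S` and whose last point is `T`. -/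
def IsCableLine (S T : Plane) (C : Set Plane) : Prop :=
  ∃ (m : ℕ) (p : ℕ → Plane), p 0 = S ∧ p m = T ∧
    C = ⋃ k ∈ Finset.range m, segment ℝ (p k) (p (k + 1))

/-- A Jordan curve (simple closed curve): the range of a continuous injective map
from the circle `AddCircle 1`. -/
def IsJordanCurve (Γ : Set Plane) : Prop :=
  ∃ f : AddCircle (1 : ℝ) → Plane, Continuous f ∧ Function.Injective f ∧ Set.range f = Γ

/-- The interior of a closed curve `Γ`: the union of the bounded connected components
of the complement of `Γ`. -/
def curveInterior (Γ : Set Plane) : Set Plane :=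
  {x | x ∉ Γ ∧ Bornology.IsBounded (connectedComponentIn Γᶜ x)}

/-- A point is exterior to `Γ` if it lies in an unbounded connected component of the
complement of `Γ` (in particular it does not lie on `Γ`). -/
def IsExteriorTo (x : Plane) (Γ : Set Plane) : Prop :=
  x ∉ Γ ∧ ¬ Bornology.IsBounded (connectedComponentIn Γᶜ x)

/-- The standard identification of the plane with `ℂ`. -/
def planeToComplex : Plane ≃L[ℝ] ℂ :=
  Complex.orthonormalBasisOneI.repr.symm.toContinuousLinearEquiv

lemma div_mem_slitPlane_of_notMem_segment {p q z : Plane} (hz : z ∉ segment ℝ p q) :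
    (planeToComplex z - planeToComplex p) / (planeToComplex z - planeToComplex q)
      ∈ Complex.slitPlane := by
  by_contra h
  have hzq : planeToComplex z - planeToComplex q ≠ 0 := by
    rw [sub_ne_zero]
    intro h'
    exact hz (planeToComplex.injective h' ▸ right_mem_segment ℝ p q)
  set w := (planeToComplex z - planeToComplex p) / (planeToComplex z - planeToComplex q) with hw
  rw [Complex.mem_slitPlane_iff] at h
  push Not at h
  obtain ⟨hre, him⟩ := h
  have hwr : w = ((w.re : ℝ) : ℂ) := Complex.ext (by simp) (by simpa using him)
  have hmul : planeToComplex z - planeToComplex p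
      = w * (planeToComplex z - planeToComplex q) := by
    rw [hw, div_mul_cancel₀ _ hzq]
  set t := w.re
  have hvec : z - p = t • (z - q) := by
    apply planeToComplex.injective
    rw [map_smul, map_sub, map_sub, hmul, hwr, Complex.real_smul]
  have ht : 0 < 1 - t := by linarith
  apply hz
  refine ⟨1 / (1 - t), -t / (1 - t), by positivity, div_nonneg (by linarith) ht.le,
    by field_simp; ring, ?_⟩
  have h2 : (1 - t) • z = p + (-t) • q := by
    have : z = t • (z - q) + p := by rw [← hvec]; simp
    calc (1 - t) • z = z - t • z := by module
      _ = (t • (z - q) + p) - t • z := by rw [← this]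
      _ = p + (-t) • q := by module
  calc (1 / (1 - t)) • p + (-t / (1 - t)) • q = (1 - t)⁻¹ • (p + (-t) • q) := by
        rw [smul_add, smul_smul, one_div, div_eq_inv_mul]
    _ = z := by rw [← h2, smul_smul, inv_mul_cancel₀ ht.ne', one_smul]

/-- The principal branch of `log ((z - p) / (z - q))`, continuous off the segment `[p, q]`. -/
def segmentLog (p q z : Plane) : ℂ :=
  Complex.log ((planeToComplex z - planeToComplex p) / (planeToComplex z - planeToComplex q))

lemma continuousOn_segmentLog (p q : Plane) :
    ContinuousOn (segmentLog p q) (segment ℝ p q)ᶜ := by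
  unfold segmentLog
  refine ContinuousOn.clog (ContinuousOn.div (by fun_prop) (by fun_prop) fun z hz => ?_)
    fun z hz => div_mem_slitPlane_of_notMem_segment hz
  rw [sub_ne_zero]
  intro h
  exact hz (planeToComplex.injective h ▸ right_mem_segment ℝ p q)

lemma exp_segmentLog {p q z : Plane} (hz : z ∉ segment ℝ p q) :
    Complex.exp (segmentLog p q z) =
      (planeToComplex z - planeToComplex p) / (planeToComplex z - planeToComplex q) :=
  Complex.exp_log (Complex.slitPlane_ne_zero (div_mem_slitPlane_of_notMem_segment hz))

lemma exp_sum_segmentLog (p : ℕ → Plane) (m : ℕ) {z : Plane} (h0 : z ≠ p 0)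
    (hz : ∀ k < m, z ∉ segment ℝ (p k) (p (k + 1))) :
    Complex.exp (∑ k ∈ Finset.range m, segmentLog (p k) (p (k + 1)) z) =
      (planeToComplex z - planeToComplex (p 0)) / (planeToComplex z - planeToComplex (p m)) := by
  induction m with
  | zero =>
    rw [Finset.sum_range_zero, Complex.exp_zero, div_self]
    exact sub_ne_zero.2 fun h => h0 (planeToComplex.injective h)
  | succ m ih =>
    have hm := hz m m.lt_succ_self
    have hne : planeToComplex z - planeToComplex (p m) ≠ 0 :=
      sub_ne_zero.2 fun h => hm (planeToComplex.injective h ▸ left_mem_segment ℝ _ _)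
    rw [Finset.sum_range_succ, Complex.exp_add, ih fun k hk => hz k (hk.trans m.lt_succ_self),
      exp_segmentLog hm, div_mul_div_cancel₀ hne]

lemma IsCableLine.exists_log {S T : Plane} {C : Set Plane} (hC : IsCableLine S T C) :
    ∃ L : Plane → ℂ, ContinuousOn L Cᶜ ∧ ∀ z ∉ C, z ≠ S → Complex.exp (L z) =
      (planeToComplex z - planeToComplex S) / (planeToComplex z - planeToComplex T) := by
  obtain ⟨m, p, rfl, rfl, rfl⟩ := hC
  refine ⟨fun z => ∑ k ∈ Finset.range m, segmentLog (p k) (p (k + 1)) z, ?_, ?_⟩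
  · refine continuousOn_finsetSum _ fun k hk => (continuousOn_segmentLog _ _).mono ?_
    exact compl_subset_compl.2 (subset_biUnion_of_mem (u := fun k => segment ℝ (p k) (p (k + 1)))
      (Finset.mem_coe.2 hk))
  · intro z hz h0
    refine exp_sum_segmentLog p m h0 fun k hk hzk => hz ?_
    exact mem_biUnion (Finset.mem_coe.2 (Finset.mem_range.2 hk)) hzk

lemma isCompact_segment (p q : Plane) : IsCompact (segment ℝ p q) := by
  rw [segment_eq_image_lineMap]
  exact isCompact_Icc.image AffineMap.lineMap_continuous

lemma isPreconnected_segment (p q : Plane) : IsPreconnected (segment ℝ p q) :=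
  (convex_segment p q).isPreconnected

lemma IsCableLine.isCompact {S T : Plane} {C : Set Plane} (hC : IsCableLine S T C) :
    IsCompact C := by
  obtain ⟨m, p, rfl, rfl, rfl⟩ := hC
  exact (Finset.range m).isCompact_biUnion fun k _ => isCompact_segment _ _

lemma isConnected_chain (p : ℕ → Plane) (m : ℕ) :
    IsPreconnected (⋃ k ∈ Finset.range (m + 1), segment ℝ (p k) (p (k + 1))) ∧
      p 0 ∈ (⋃ k ∈ Finset.range (m + 1), segment ℝ (p k) (p (k + 1))) ∧
      p (m + 1) ∈ (⋃ k ∈ Finset.range (m + 1), segment ℝ (p k) (p (k + 1))) := by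
  induction m with
  | zero => simp [isPreconnected_segment, left_mem_segment, right_mem_segment]
  | succ m ih =>
    rw [Finset.range_add_one (n := m + 1), Finset.set_biUnion_insert]
    exact ⟨IsPreconnected.union (p (m + 1)) (left_mem_segment ℝ _ _) ih.2.2
      (isPreconnected_segment _ _) ih.1, Or.inr ih.2.1, Or.inl (right_mem_segment ℝ _ _)⟩

lemma IsCableLine.isPreconnected_and_mem {S T : Plane} {C : Set Plane} (hC : IsCableLine S T C)
    (hne : C.Nonempty) : IsPreconnected C ∧ S ∈ C ∧ T ∈ C := by
  obtain ⟨m, p, rfl, rfl, rfl⟩ := hC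
  cases m with
  | zero => simp at hne
  | succ m => exact isConnected_chain p m

lemma IsPreconnected.eq_of_exp_eq_one {X : Type*} [TopologicalSpace X] {A : Set X}
    (hA : IsPreconnected A) {h : X → ℂ} (hc : ContinuousOn h A)
    (h1 : ∀ x ∈ A, Complex.exp (h x) = 1) {x y : X} (hx : x ∈ A) (hy : y ∈ A) : h x = h y := by
  have key : h x / (2 * Real.pi * Complex.I) = h y / (2 * Real.pi * Complex.I) := by
    refine hA.constant_of_mapsTo (T := range ((↑) : ℤ → ℂ)) ?_
      (f := fun x => h x / (2 * Real.pi * Complex.I)) (hc.div_const _) ?_ hx hy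
    · exact Complex.isClosedEmbedding_intCast.isEmbedding.isDiscrete_range
    · intro z hz
      obtain ⟨n, hn⟩ := Complex.exp_eq_one_iff.1 (h1 z hz)
      exact ⟨n, by simp only [hn]; rw [mul_div_cancel_right₀ _ Complex.two_pi_I_ne_zero]⟩
  exact (div_left_inj' Complex.two_pi_I_ne_zero).1 key

lemma not_exists_log_on_sphere {R : ℝ} (hR : 0 < R) (a : ℂ) (g : ℂ → ℂ) (hg : Continuous g)
    (h : ∀ z ∈ Metric.sphere a R, Complex.exp (g z) = z - a) : False := by
  have hmem : ∀ θ : ℝ, circleMap a R θ ∈ Metric.sphere a R := circleMap_mem_sphere a hR.le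
  have hlogR : Complex.exp (Real.log R : ℝ) = R := by
    rw [← Complex.ofReal_exp, Real.exp_log hR]
  have hconst := (isPreconnected_univ (α := ℝ)).eq_of_exp_eq_one
    (h := fun θ : ℝ => g (circleMap a R θ) - (Real.log R : ℝ) - θ * Complex.I)
    (by
      have := continuous_circleMap a R
      fun_prop)
    (fun θ _ => by
      rw [Complex.exp_sub, Complex.exp_sub, h _ (hmem θ), hlogR, circleMap_sub_center,
        circleMap_zero, mul_div_cancel_left₀ _ (by exact_mod_cast hR.ne'),
        div_self (Complex.exp_ne_zero _)])
    (mem_univ 0) (mem_univ (2 * Real.pi))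
  have hper : circleMap a R (2 * Real.pi) = circleMap a R 0 := by simp [circleMap]
  simp only [hper] at hconst
  have : (2 * Real.pi * Complex.I : ℂ) = 0 := by
    push_cast at hconst
    linear_combination hconst
  exact Complex.two_pi_I_ne_zero this

lemma exists_continuous_log {F : ℂ → ℂ} (hF : Continuous F) (h0 : ∀ z, F z ≠ 0) :
    ∃ g : ℂ → ℂ, Continuous g ∧ ∀ z, Complex.exp (g z) = F z := by
  have hsc : IsSimplyConnected (univ : Set ℂ) := by
    have : ContractibleSpace (univ : Set ℂ) := (Homeomorph.Set.univ ℂ).contractibleSpace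
    exact SimplyConnectedSpace.ofContractible _
  obtain ⟨g, hg, he⟩ := Complex.exists_continuousOn_eqOn_exp_comp hsc isOpen_univ
    hF.continuousOn (by simpa using h0)
  exact ⟨g, continuousOn_univ.1 hg, fun z => he (mem_univ z)⟩

lemma closure_connectedComponentIn_compl_subset {K : Set Plane} {a : Plane} (ha : a ∉ K) :
    closure (connectedComponentIn Kᶜ a) ⊆ connectedComponentIn Kᶜ a ∪ K := by
  intro z hz
  by_cases hzK : z ∈ K
  · exact Or.inr hzK
  refine Or.inl ?_
  have hpre : IsPreconnected (insert z (connectedComponentIn Kᶜ a)) :=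
    isPreconnected_connectedComponentIn.subset_closure (subset_insert _ _)
      (insert_subset hz subset_closure)
  exact hpre.subset_connectedComponentIn (Or.inr (mem_connectedComponentIn ha))
    (insert_subset hzK (connectedComponentIn_subset _ _)) (Or.inl rfl)

/-- If a compact set `K` separates `a` from `b`, with `a` in a bounded component, then
`(z - a) / (z - b)` has no continuous logarithm on `K`. -/
lemma not_exists_log_of_separated {K : Set Plane} (hK : IsCompact K) {a b : Plane}
    (ha : a ∈ curveInterior K) (hb : IsExteriorTo b K) {g : Plane → ℂ} (hg : ContinuousOn g K)
    (hexp : ∀ z ∈ K, Complex.exp (g z) =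
      (planeToComplex z - planeToComplex a) / (planeToComplex z - planeToComplex b)) : False := by
  classical
  obtain ⟨haK, hbdd⟩ := ha
  obtain ⟨hbK, hunb⟩ := hb
  set U := connectedComponentIn Kᶜ a with hU
  have haU : a ∈ U := mem_connectedComponentIn haK
  have hUo : IsOpen U := hK.isClosed.isOpen_compl.connectedComponentIn
  have hbU : b ∉ U := fun h => hunb (connectedComponentIn_eq h ▸ hbdd)
  have hfr : frontier U ⊆ K := by
    rw [hUo.frontier_eq]
    rintro z ⟨hz, hzU⟩
    exact (closure_connectedComponentIn_compl_subset haK hz).resolve_left hzU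
  obtain ⟨G, hG⟩ := ContinuousMap.exists_restrict_eq (Y := ℂ) hK.isClosed
    ⟨K.domRestrict g, continuousOn_iff_continuous_domRestrict.1 hg⟩
  have hGg : ∀ z ∈ K, G z = g z := fun z hz => by
    simpa using congrArg (fun f => f ⟨z, hz⟩) hG
  let F : Plane → ℂ := fun z => if z ∈ U then
    Complex.exp (G z) * (planeToComplex z - planeToComplex b)
    else planeToComplex z - planeToComplex a
  have hFc : Continuous F := by
    refine Continuous.if ?_ (by fun_prop) (by fun_prop)
    intro z hz
    have hzK := hfr hz
    have hzb : planeToComplex z - planeToComplex b ≠ 0 :=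
      sub_ne_zero.2 fun h => hbK (planeToComplex.injective h ▸ hzK)
    rw [hGg z hzK, hexp z hzK, div_mul_cancel₀ _ hzb]
  have hF0 : ∀ z, F z ≠ 0 := by
    intro z
    by_cases hz : z ∈ U
    · simp only [F, if_pos hz]
      exact mul_ne_zero (Complex.exp_ne_zero _)
        (sub_ne_zero.2 fun h => hbU (planeToComplex.injective h ▸ hz))
    · simp only [F, if_neg hz]
      exact sub_ne_zero.2 fun h => hz (planeToComplex.injective h ▸ haU)
  obtain ⟨l, hlc, hl⟩ := exists_continuous_log (hFc.comp planeToComplex.symm.continuous)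
    fun z => hF0 _
  have hbddC : Bornology.IsBounded (planeToComplex '' U) :=
    planeToComplex.lipschitz.isBounded_image hbdd
  obtain ⟨R, hR0, hR⟩ := hbddC.subset_ball_lt 0 (planeToComplex a)
  refine not_exists_log_on_sphere hR0 (planeToComplex a) l hlc fun z hz => ?_
  rw [hl]
  have hzU : planeToComplex.symm z ∉ U := fun h => by
    have := hR (mem_image_of_mem planeToComplex h)
    rw [ContinuousLinearEquiv.apply_symm_apply, Metric.mem_ball] at this
    exact this.ne hz
  simp [F, hzU]

lemma isPreconnected_norm_gt {R : ℝ} (hR : 0 ≤ R) : IsPreconnected {z : Plane | R < ‖z‖} := by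
  have hrank : 1 < Module.rank ℝ Plane := by
    rw [← Module.finrank_eq_rank, finrank_euclideanSpace_fin]
    norm_num
  have h := ((isPreconnected_Ioi (a := R)).prod (isPreconnected_sphere hrank (0 : Plane) 1)).image
    (fun x : ℝ × Plane => x.1 • x.2) (by fun_prop)
  convert h using 1
  ext z
  constructor
  · intro hz
    have h0 : 0 < ‖z‖ := hR.trans_lt hz
    refine ⟨(‖z‖, ‖z‖⁻¹ • z), ⟨hz, ?_⟩, ?_⟩
    · simp [norm_smul, h0.ne']
    · simp [smul_smul, h0.ne']
  · rintro ⟨⟨t, s⟩, ⟨ht, hs⟩, rfl⟩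
    have ht' : R < t := ht
    have hs' : ‖s‖ = 1 := by simpa using hs
    simp only [mem_ofPred_eq, norm_smul, hs', mul_one, Real.norm_eq_abs]
    exact ht'.trans_le (le_abs_self t)

/-- A continuous logarithm of `1` on the complement of a bounded set takes the same value at all
exterior points. -/
lemma eq_of_isExteriorTo {K : Set Plane} (hK : Bornology.IsBounded K) {h : Plane → ℂ}
    (hc : ContinuousOn h Kᶜ) (h1 : ∀ z ∈ Kᶜ, Complex.exp (h z) = 1) {x y : Plane}
    (hx : IsExteriorTo x K) (hy : IsExteriorTo y K) : h x = h y := by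
  obtain ⟨R, hR0, hR⟩ := hK.subset_closedBall_lt 0 0
  have hsub : {z : Plane | R < ‖z‖} ⊆ Kᶜ := fun z hz hzK => by
    have := hR hzK
    rw [mem_closedBall_zero_iff] at this
    exact absurd hz (not_lt.2 this)
  have far : ∀ x, IsExteriorTo x K → ∃ z, R < ‖z‖ ∧ h x = h z := by
    intro x hx
    by_contra! hcon
    refine hx.2 ((Metric.isBounded_closedBall (x := (0 : Plane)) (r := R)).subset fun z hz => ?_)
    rw [mem_closedBall_zero_iff]
    by_contra! hz'
    exact hcon z hz' (isPreconnected_connectedComponentIn.eq_of_exp_eq_one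
      (hc.mono (connectedComponentIn_subset _ _))
      (fun w hw => h1 w (connectedComponentIn_subset _ _ hw))
      (mem_connectedComponentIn hx.1) hz)
  obtain ⟨z, hz, hxz⟩ := far x hx
  obtain ⟨w, hw, hyw⟩ := far y hy
  rw [hxz, hyw]
  exact (isPreconnected_norm_gt hR0.le).eq_of_exp_eq_one (hc.mono hsub)
    (fun v hv => h1 v (hsub hv)) hz hw

/-- On a Jordan curve, a connected subset containing the endpoints of a segment of the curve, but
missing a point of the curve outside that segment, contains the segment. -/
lemma IsJordanCurve.segment_subset {K C : Set Plane} (hK : IsJordanCurve K)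
    (hC : IsPreconnected C) (hCK : C ⊆ K) {x y q : Plane} (hx : x ∈ C) (hy : y ∈ C)
    (hxy : segment ℝ x y ⊆ K) (hqK : q ∈ K) (hqC : q ∉ C) (hq : q ∉ segment ℝ x y) :
    segment ℝ x y ⊆ C := by
  rcases eq_or_ne x y with rfl | hne
  · simpa using hx
  obtain ⟨f, hfc, hfi, rfl⟩ := hK
  have : Fact ((0 : ℝ) < 1) := ⟨one_pos⟩
  have hemb := (hfc.isClosedEmbedding hfi).isEmbedding
  obtain ⟨a, rfl⟩ := hqK
  obtain ⟨a, rfl⟩ := QuotientAddGroup.mk_surjective a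
  set r := Function.invFun f
  have hr : ∀ z ∈ range f, f (r z) = z := fun z hz => Function.invFun_eq hz
  let ψ : AddCircle (1 : ℝ) → ℝ := fun z => AddCircle.equivIco 1 a z
  have hψi : Function.Injective ψ := Subtype.val_injective.comp (AddCircle.equivIco 1 a).injective
  have hψc : ContinuousOn ψ {(a : AddCircle (1 : ℝ))}ᶜ := fun z hz =>
    (continuousAt_subtype_val.comp (AddCircle.continuousAt_equivIco 1 a hz)).continuousWithinAt
  have hC' : IsPreconnected (f ⁻¹' C) := by
    rw [← hemb.isInducing.isPreconnected_image, image_preimage_eq_of_subset hCK]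
    exact hC
  have hord : (ψ '' (f ⁻¹' C)).OrdConnected :=
    (hC'.image ψ (hψc.mono fun z hz h => hqC (by rw [← mem_singleton_iff.1 h]; exact hz))).ordConnected
  have hseg : ∀ t ∈ Icc (0 : ℝ) 1, AffineMap.lineMap x y t ∈ segment ℝ x y := fun t ht => by
    rw [segment_eq_image_lineMap]
    exact mem_image_of_mem _ ht
  let l : ℝ → AddCircle (1 : ℝ) := fun t => r (AffineMap.lineMap x y t)
  have hfl : ∀ t ∈ Icc (0 : ℝ) 1, f (l t) = AffineMap.lineMap x y t := fun t ht =>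
    hr _ (hxy (hseg t ht))
  have hlc : ContinuousOn l (Icc 0 1) := by
    rw [hemb.isInducing.continuousOn_iff]
    exact (AffineMap.lineMap_continuous (R := ℝ)).continuousOn.congr hfl
  have hli : InjOn l (Icc 0 1) := fun s hs t ht hst => by
    have := congrArg f hst
    rw [hfl s hs, hfl t ht] at this
    exact AffineMap.lineMap_injective ℝ hne this
  have huc : ContinuousOn (ψ ∘ l) (Icc 0 1) := hψc.comp hlc fun t ht h => by
    apply hq
    have := hseg t ht
    rw [← hfl t ht, mem_singleton_iff.1 h] at this
    exact this
  have h0 : (0 : ℝ) ∈ Icc (0 : ℝ) 1 := by simp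
  have h1 : (1 : ℝ) ∈ Icc (0 : ℝ) 1 := by simp
  have hm0 : ψ (l 0) ∈ ψ '' (f ⁻¹' C) := mem_image_of_mem _ (by
    rw [mem_preimage, hfl 0 h0]; simpa using hx)
  have hm1 : ψ (l 1) ∈ ψ '' (f ⁻¹' C) := mem_image_of_mem _ (by
    rw [mem_preimage, hfl 1 h1]; simpa using hy)
  rw [segment_eq_image_lineMap]
  rintro _ ⟨t, ht, rfl⟩
  have hmem : ψ (l t) ∈ ψ '' (f ⁻¹' C) := by
    rcases huc.strictMonoOn_of_injOn_Icc' zero_le_one (hψi.comp_injOn hli) with h | h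
    · exact hord.out hm0 hm1 ⟨h.monotoneOn h0 ht ht.1, h.monotoneOn ht h1 ht.2⟩
    · exact hord.out hm1 hm0 ⟨h.antitoneOn ht h1 ht.2, h.antitoneOn h0 ht ht.1⟩
  rw [hψi.mem_set_image, mem_preimage, hfl t ht] at hmem
  exact hmem

lemma eq_of_mem_segment_of_mem_segment {S T x q : Plane} (hx : x ∈ segment ℝ S T)
    (hq : q ∈ segment ℝ S x) (hq' : q ∈ segment ℝ x T) : q = x := by
  have h1 := dist_add_dist_of_mem_segment hx
  have h2 := dist_add_dist_of_mem_segment hq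
  have h3 := dist_add_dist_of_mem_segment hq'
  have h4 := dist_triangle S q T
  have h5 := dist_comm x q
  have h6 := dist_nonneg (x := q) (y := x)
  exact dist_le_zero.1 (by linarith)

/-- In a Jordan curve made of a segment and a connected set through its endpoints, every point
common to both is joined inside both to an endpoint of the segment. -/
lemma IsJordanCurve.segment_subset_or_segment_subset {S T : Plane} {C : Set Plane}
    (hK : IsJordanCurve (C ∪ segment ℝ T S)) (hC : IsPreconnected C) (hT : T ∈ C) {x : Plane}
    (hxC : x ∈ C) (hx : x ∈ segment ℝ S T) : segment ℝ S x ⊆ C ∨ segment ℝ x T ⊆ C := by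
  by_contra! h
  obtain ⟨q, hq, hqC⟩ := not_subset.1 h.1
  have hconv := convex_segment (𝕜 := ℝ) S T
  have hsub : segment ℝ S x ⊆ segment ℝ S T := hconv.segment_subset (left_mem_segment ℝ S T) hx
  have hsub' : segment ℝ x T ⊆ segment ℝ S T := hconv.segment_subset hx (right_mem_segment ℝ S T)
  rw [segment_symm ℝ T S] at hK
  exact h.2 (hK.segment_subset hC subset_union_left hxC hT
    (hsub'.trans subset_union_right) (Or.inr (hsub hq)) hqC
    fun hq' => hqC (eq_of_mem_segment_of_mem_segment hx hq hq' ▸ hxC))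

/-- If `Tᵢ` lies in the interior of robot `j`'s cable polygon while `Sᵢ`, `Sⱼ`, `Tⱼ`
are all exterior to the other robot's cable polygon, then the straight-line segments
`[Sᵢ, Tᵢ]` and `[Sⱼ, Tⱼ]` must intersect. -/
theorem pair_interaction_type2
    (Si Ti Sj Tj : Plane) (Ci Cj : Set Plane)
    (hCi : IsCableLine Si Ti Ci) (hCj : IsCableLine Sj Tj Cj)
    (hdisj : Disjoint Ci Cj)
    (hJi : IsJordanCurve (Ci ∪ segment ℝ Ti Si))
    (hJj : IsJordanCurve (Cj ∪ segment ℝ Tj Sj))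
    (hSi : IsExteriorTo Si (Cj ∪ segment ℝ Tj Sj))
    (hSj : IsExteriorTo Sj (Ci ∪ segment ℝ Ti Si))
    (hTj : IsExteriorTo Tj (Ci ∪ segment ℝ Ti Si))
    (hTi : Ti ∈ curveInterior (Cj ∪ segment ℝ Tj Sj)) :
    (segment ℝ Si Ti ∩ segment ℝ Sj Tj).Nonempty := by
  classical
  by_contra hempty
  rw [not_nonempty_iff_eq_empty, ← disjoint_iff_inter_eq_empty, segment_symm ℝ Si Ti] at hempty
  obtain ⟨L, hLc, hL⟩ := hCi.exists_log
  set Γ := Ci ∪ segment ℝ Ti Si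
  set h : Plane → ℂ := fun z => segmentLog Ti Si z + L z with hh
  have hhc : ContinuousOn h Γᶜ :=
    ((continuousOn_segmentLog Ti Si).mono (compl_subset_compl.2 subset_union_right)).add
      (hLc.mono (compl_subset_compl.2 subset_union_left))
  have hexpL : ∀ z ∉ Ci, z ≠ Si → Complex.exp (-L z) =
      (planeToComplex z - planeToComplex Ti) / (planeToComplex z - planeToComplex Si) := by
    intro z hz hzS
    rw [Complex.exp_neg, hL z hz hzS, inv_div]
  have hh1 : ∀ z ∈ Γᶜ, Complex.exp (h z) = 1 := by
    intro z hz
    have hzC : z ∉ Ci := fun h => hz (Or.inl h)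
    have hzs : z ∉ segment ℝ Ti Si := fun h => hz (Or.inr h)
    have hzS : z ≠ Si := fun h => hzs (h ▸ right_mem_segment ℝ _ _)
    have : h z = segmentLog Ti Si z - -L z := by simp [hh]
    rw [this, Complex.exp_sub, hexpL z hzC hzS, ← exp_segmentLog hzs,
      div_self (Complex.exp_ne_zero _)]
  have hΓc : IsCompact Γ := hCi.isCompact.union (isCompact_segment _ _)
  have hST : h Sj = h Tj := eq_of_isExteriorTo hΓc.isBounded hhc hh1 hSj hTj
  have hinter : Cj ∩ segment ℝ Sj Tj ⊆ Γᶜ := by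
    rintro z ⟨hzC, hzs⟩ (hz | hz)
    · exact hdisj.notMem_of_mem_left hz hzC
    · exact hempty.notMem_of_mem_left hz hzs
  have hsegconst : ∀ u v, u ∈ segment ℝ Sj Tj → v ∈ segment ℝ Sj Tj → segment ℝ u v ⊆ Cj →
      h u = h v := by
    intro u v hu hv huv
    have hsub : segment ℝ u v ⊆ Γᶜ := fun z hz =>
      hinter ⟨huv hz, (convex_segment Sj Tj).segment_subset hu hv hz⟩
    exact (isPreconnected_segment u v).eq_of_exp_eq_one (hhc.mono hsub)
      (fun z hz => hh1 z (hsub hz)) (left_mem_segment ℝ u v) (right_mem_segment ℝ u v)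
  have hconst : ∀ x ∈ Cj, x ∈ segment ℝ Sj Tj → h x = h Sj := by
    intro x hxC hx
    obtain ⟨hpre, -, hTC⟩ := hCj.isPreconnected_and_mem ⟨x, hxC⟩
    rcases hJj.segment_subset_or_segment_subset hpre hTC hxC hx with hs | hs
    · exact (hsegconst Sj x (left_mem_segment ℝ _ _) hx hs).symm
    · exact (hsegconst x Tj hx (right_mem_segment ℝ _ _) hs).trans hST.symm
  let g : Plane → ℂ := fun z =>
    if z ∈ segment ℝ Sj Tj then segmentLog Ti Si z else -L z + h Sj
  have hg1 : EqOn g (segmentLog Ti Si) (segment ℝ Sj Tj) := fun z hz => if_pos hz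
  have hg2 : EqOn g (fun z => -L z + h Sj) Cj := by
    intro z hz
    by_cases hzs : z ∈ segment ℝ Sj Tj
    · have hz' : segmentLog Ti Si z + L z = h Sj := hconst z hz hzs
      rw [hg1 hzs]
      linear_combination hz'
    · exact if_neg hzs
  have hexpS : Complex.exp (h Sj) = 1 := hh1 Sj hSj.1
  have hsub1 : segment ℝ Sj Tj ⊆ (segment ℝ Ti Si)ᶜ := fun z hz hz' =>
    hempty.notMem_of_mem_left hz' hz
  have hsub2 : Cj ⊆ Ciᶜ := fun z hz hz' => hdisj.notMem_of_mem_left hz' hz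
  rw [segment_symm ℝ Tj Sj] at hSi hTi
  refine not_exists_log_of_separated (hCj.isCompact.union (isCompact_segment Sj Tj)) hTi hSi
    (g := g) ?_ ?_
  · refine ContinuousOn.union_of_isClosed ?_ ?_ hCj.isCompact.isClosed
      (isCompact_segment Sj Tj).isClosed
    · exact ((hLc.mono hsub2).neg.add continuousOn_const).congr hg2
    · exact ((continuousOn_segmentLog Ti Si).mono hsub1).congr hg1
  · rintro z (hz | hz)
    · rw [hg2 hz, Complex.exp_add, hexpS, mul_one]
      exact hexpL z (hsub2 hz) fun h => hSi.1 (h ▸ Or.inl hz)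
    · rw [hg1 hz, exp_segmentLog (hsub1 hz)]
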